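/- Let M be a finitely generated projective module over a commutative unital ring k, let x, y, z ∈ Λ_l(M) and μ ∈ Λ_{3l}(M*). Then e(xyz, μ) = e(x, (yz)·μ) + e(y, (zx)·μ) + e(z, (xy)·μ) in End_k(M), i.e. e(xyz,μ) equals the sum over the cyclic permutations of x, y, z of e(x, (yz)·μ). -/

import Mathlib

open ExteriorAlgebra

/-- The algebra homomorphism `Δ : Λ(M*) → End(Λ(M))` extending the contraction
`φ ↦ Δ_φ`, so that `Δ(ξ)(x) = ξ·x`. -/
noncomputable def extDelta (R : Type*) [CommRing R] (M : Type*) [AddCommGroup M] [Module R M] :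
    ExteriorAlgebra R (Module.Dual R M) →ₐ[R] Module.End R (ExteriorAlgebra R M) :=
  ExteriorAlgebra.lift R ⟨CliffordAlgebra.contractLeft (Q := (0 : QuadraticForm R M)),
    fun d => LinearMap.ext fun x => CliffordAlgebra.contractLeft_contractLeft d x⟩

/-- The algebra homomorphism `Δ' : Λ(M) → End(Λ(M*))` obtained from contraction via
the canonical map `M → M**`, so that `Δ'(x)(ξ) = x·ξ`. -/
noncomputable def extDelta' (R : Type*) [CommRing R] (M : Type*) [AddCommGroup M] [Module R M] :
    ExteriorAlgebra R M →ₐ[R] Module.End R (ExteriorAlgebra R (Module.Dual R M)) :=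
  ExteriorAlgebra.lift R
    ⟨(CliffordAlgebra.contractLeft
        (Q := (0 : QuadraticForm R (Module.Dual R M)))).comp (Module.Dual.eval R M),
      fun _ => LinearMap.ext fun ξ => CliffordAlgebra.contractLeft_contractLeft _ ξ⟩

/-- The endomorphism `e(x,ξ)` of `M`, `m ↦ (m·ξ)·x`, where the result is viewed in
`M` via the (partial) inverse `ιInv` of `ι : M → Λ(M)`; for `x ∈ Λ_l(M)` and
`ξ ∈ Λ_l(M*)` the element `(m·ξ)·x` indeed lies in `Λ₁(M) = M`. -/
noncomputable def extE (R : Type*) [CommRing R] (M : Type*) [AddCommGroup M] [Module R M]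
    (x : ExteriorAlgebra R M) (ξ : ExteriorAlgebra R (Module.Dual R M)) :
    Module.End R M :=
  ιInv ∘ₗ LinearMap.applyₗ x ∘ₗ (extDelta R M).toLinearMap ∘ₗ
    LinearMap.applyₗ ξ ∘ₗ (extDelta' R M).toLinearMap ∘ₗ ι R

section

variable {R : Type*} [CommRing R] {M : Type*} [AddCommGroup M] [Module R M]

/-- Contraction on the right of an exterior algebra element by a linear form. -/
noncomputable def contractR (φ : Module.Dual R M) : ExteriorAlgebra R M →ₗ[R] ExteriorAlgebra R M :=
  (CliffordAlgebra.contractRight (Q := (0 : QuadraticForm R M))).flip φ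

lemma contractR_mul_ι (φ : Module.Dual R M) (a : ExteriorAlgebra R M) (m : M) :
    contractR φ (a * ι R m) = φ m • a - contractR φ a * ι R m :=
  CliffordAlgebra.contractRight_mul_ι (Q := (0 : QuadraticForm R M)) φ m a

lemma contractR_algebraMap (φ : Module.Dual R M) (r : R) :
    contractR φ (algebraMap R (ExteriorAlgebra R M) r) = 0 :=
  CliffordAlgebra.contractRight_algebraMap (Q := (0 : QuadraticForm R M)) φ r

lemma exteriorAlgebra_right_induction {P : ExteriorAlgebra R M → Prop}
    (algebraMap : ∀ r : R, P (algebraMap R (ExteriorAlgebra R M) r))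
    (add : ∀ a b, P a → P b → P (a + b))
    (mul_ι : ∀ (m : M) (a), P a → P (a * ι R m)) (a : ExteriorAlgebra R M) : P a :=
  CliffordAlgebra.right_induction (Q := (0 : QuadraticForm R M)) (P := P) algebraMap add mul_ι a

lemma exteriorAlgebra_left_induction {P : ExteriorAlgebra R M → Prop}
    (algebraMap : ∀ r : R, P (algebraMap R (ExteriorAlgebra R M) r))
    (add : ∀ a b, P a → P b → P (a + b))
    (ι_mul : ∀ (a) (m : M), P a → P (ι R m * a)) (a : ExteriorAlgebra R M) : P a :=
  CliffordAlgebra.left_induction (Q := (0 : QuadraticForm R M)) (P := P) algebraMap add ι_mul a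

lemma extDelta_ι (φ : Module.Dual R M) :
    extDelta R M (ι R φ) = CliffordAlgebra.contractLeft (Q := (0 : QuadraticForm R M)) φ := by
  simp [extDelta]

lemma extDelta_ι_ι_mul (φ : Module.Dual R M) (m : M) (a : ExteriorAlgebra R M) :
    extDelta R M (ι R φ) (ι R m * a) = φ m • a - ι R m * extDelta R M (ι R φ) a := by
  rw [extDelta_ι]
  exact CliffordAlgebra.contractLeft_ι_mul (Q := (0 : QuadraticForm R M)) φ m a

lemma extDelta_ι_algebraMap (φ : Module.Dual R M) (r : R) :
    extDelta R M (ι R φ) (algebraMap R _ r) = 0 := by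
  rw [extDelta_ι]
  exact CliffordAlgebra.contractLeft_algebraMap (Q := (0 : QuadraticForm R M)) φ r

lemma extDelta'_ι (m : M) :
    extDelta' R M (ι R m) = CliffordAlgebra.contractLeft
      (Q := (0 : QuadraticForm R (Module.Dual R M))) (Module.Dual.eval R M m) := by
  simp [extDelta']

lemma extDelta'_ι_ι_mul (m : M) (φ : Module.Dual R M) (ξ : ExteriorAlgebra R (Module.Dual R M)) :
    extDelta' R M (ι R m) (ι R φ * ξ) = φ m • ξ - ι R φ * extDelta' R M (ι R m) ξ := by
  rw [extDelta'_ι]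
  exact CliffordAlgebra.contractLeft_ι_mul (Q := (0 : QuadraticForm R (Module.Dual R M)))
    (Module.Dual.eval R M m) φ ξ

lemma extDelta'_ι_algebraMap (m : M) (r : R) :
    extDelta' R M (ι R m) (algebraMap R _ r) = 0 := by
  rw [extDelta'_ι]
  exact CliffordAlgebra.contractLeft_algebraMap (Q := (0 : QuadraticForm R (Module.Dual R M))) _ r

lemma algebraMapInv_ι (m : M) : algebraMapInv (ι R m) = (0 : R) := by
  simp [algebraMapInv]

lemma dual_ιInv (φ : Module.Dual R M) (a : ExteriorAlgebra R M) :
    φ (ιInv a) = algebraMapInv (extDelta R M (ι R φ) a) := by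
  induction a using exteriorAlgebra_left_induction with
  | algebraMap r =>
    rw [extDelta_ι_algebraMap]
    simp [ιInv, TrivSqZeroExt.algebraMap_eq_inl]
  | add a b ha hb => simp [ha, hb]
  | ι_mul a m _ =>
    let _ : Module Rᵐᵒᵖ M := Module.compHom _ ((RingHom.id R).fromOpposite mul_comm)
    have : IsCentralScalar R M := ⟨fun r m => rfl⟩
    have h : (toTrivSqZeroExt a : TrivSqZeroExt R M).fst = algebraMapInv a := by
      have : (TrivSqZeroExt.fstHom R R M).comp toTrivSqZeroExt = algebraMapInv := by
        ext v
        simp [algebraMapInv_ι]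
      exact DFunLike.congr_fun this a
    rw [extDelta_ι_ι_mul, map_sub, map_mul algebraMapInv, algebraMapInv_ι, zero_mul, sub_zero, map_smul]
    change φ (TrivSqZeroExt.snd (toTrivSqZeroExt (ι R m * a))) = _
    rw [map_mul, toTrivSqZeroExt_ι]
    simp [h, mul_comm]

lemma algebraMapInv_contractR (φ : Module.Dual R M) (a : ExteriorAlgebra R M) :
    algebraMapInv (contractR φ a) = algebraMapInv (extDelta R M (ι R φ) a) := by
  induction a using exteriorAlgebra_right_induction with
  | algebraMap r => rw [extDelta_ι_algebraMap, contractR_algebraMap]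
  | add a b ha hb => simp [ha, hb]
  | mul_ι m a ih =>
    rw [contractR_mul_ι, map_sub, map_mul, algebraMapInv_ι, mul_zero, sub_zero]
    clear ih
    induction a using exteriorAlgebra_left_induction with
    | algebraMap r =>
      rw [← Algebra.smul_def, map_smul (extDelta R M _), ← mul_one (ι R m), extDelta_ι_ι_mul]
      simp [algebraMapInv_ι, Algebra.algebraMap_eq_smul_one, mul_comm]
    | add a b ha hb => simp [add_mul, smul_add, ha, hb]
    | ι_mul a v _ =>
      rw [mul_assoc, extDelta_ι_ι_mul]
      simp [algebraMapInv_ι]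

lemma contractR_involute (φ : Module.Dual R M) (a : ExteriorAlgebra R M) :
    contractR φ (CliffordAlgebra.involute a) = -CliffordAlgebra.involute (contractR φ a) := by
  induction a using exteriorAlgebra_right_induction with
  | algebraMap r => rw [AlgHom.commutes, contractR_algebraMap, map_zero, neg_zero]
  | add a b ha hb => rw [map_add, map_add, ha, hb, map_add, map_add, neg_add]
  | mul_ι m a ha =>
    rw [map_mul, CliffordAlgebra.involute_ι, mul_neg, map_neg, contractR_mul_ι,
      contractR_mul_ι, ha, map_sub, map_smul, map_mul, CliffordAlgebra.involute_ι]
    simp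

lemma contractLeft_mul_ι (φ : Module.Dual R M) (a : ExteriorAlgebra R M) (m : M) :
    CliffordAlgebra.contractLeft (Q := (0 : QuadraticForm R M)) φ (a * ι R m) =
      CliffordAlgebra.contractLeft φ a * ι R m + φ m • CliffordAlgebra.involute a := by
  induction a using exteriorAlgebra_left_induction with
  | algebraMap r =>
    rw [CliffordAlgebra.contractLeft_algebraMap_mul, CliffordAlgebra.contractLeft_ι,
      CliffordAlgebra.contractLeft_algebraMap, AlgHom.commutes, zero_mul, zero_add,
      Algebra.smul_def, Algebra.commutes]
  | add a b ha hb =>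
    rw [add_mul, map_add, ha, hb, map_add, map_add, add_mul, smul_add]
    abel
  | ι_mul a v ha =>
    rw [mul_assoc, CliffordAlgebra.contractLeft_ι_mul, ha, CliffordAlgebra.contractLeft_ι_mul,
      map_mul, CliffordAlgebra.involute_ι, sub_mul, smul_mul_assoc, mul_add, mul_smul_comm,
      neg_mul, smul_neg, mul_assoc]
    abel

lemma contractLeft_contractR (φ ψ : Module.Dual R M) (a : ExteriorAlgebra R M) :
    CliffordAlgebra.contractLeft (Q := (0 : QuadraticForm R M)) ψ (contractR φ a) =
      contractR φ (CliffordAlgebra.contractLeft ψ a) := by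
  induction a using exteriorAlgebra_right_induction with
  | algebraMap r =>
    rw [contractR_algebraMap, CliffordAlgebra.contractLeft_algebraMap, map_zero, map_zero]
  | add a b ha hb => rw [map_add, map_add, ha, hb, map_add, map_add]
  | mul_ι m a ha =>
    rw [contractLeft_mul_ι, contractR_mul_ι, map_sub, map_smul, contractLeft_mul_ι, ha,
      map_add, map_smul, contractR_mul_ι, contractR_involute, smul_neg]
    abel

lemma contractR_extDelta (φ : Module.Dual R M) (ξ : ExteriorAlgebra R (Module.Dual R M))
    (a : ExteriorAlgebra R M) :
    extDelta R M ξ (contractR φ a) = contractR φ (extDelta R M ξ a) := by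
  induction ξ using exteriorAlgebra_left_induction generalizing a with
  | algebraMap r => simp [Module.algebraMap_end_apply]
  | add ξ η hξ hη => simp [hξ, hη]
  | ι_mul ξ ψ hξ =>
    rw [map_mul, Module.End.mul_apply, Module.End.mul_apply, hξ, extDelta_ι]
    exact contractLeft_contractR _ _ _

lemma algebraMapInv_extDelta'_ι_mul (a : ExteriorAlgebra R M) (φ : Module.Dual R M)
    (ξ : ExteriorAlgebra R (Module.Dual R M)) :
    algebraMapInv (extDelta' R M a (ι R φ * ξ)) =
      algebraMapInv (extDelta' R M (contractR φ a) ξ) := by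
  induction a using exteriorAlgebra_right_induction generalizing ξ with
  | algebraMap r => simp [contractR_algebraMap, Module.algebraMap_end_apply, algebraMapInv_ι]
  | add a b ha hb => simp [ha, hb]
  | mul_ι m a ha =>
    simp [contractR_mul_ι, extDelta'_ι_ι_mul, ha]

/-- The scalar pairings between the exterior algebras of `M` and its dual defined by the two
contraction actions coincide. -/
lemma algebraMapInv_extDelta_eq (ξ : ExteriorAlgebra R (Module.Dual R M))
    (a : ExteriorAlgebra R M) :
    algebraMapInv (extDelta R M ξ a) = algebraMapInv (extDelta' R M a ξ) := by
  induction ξ using exteriorAlgebra_left_induction generalizing a with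
  | algebraMap r =>
    induction a using exteriorAlgebra_right_induction with
    | algebraMap s => simp [Module.algebraMap_end_apply, mul_comm]
    | add a b ha hb => simp_all
    | mul_ι m a _ =>
      rw [map_mul (extDelta' R M), Module.End.mul_apply, extDelta'_ι_algebraMap]
      simp [Module.algebraMap_end_apply, algebraMapInv_ι]
  | add ξ η hξ hη => simp [hξ, hη]
  | ι_mul ξ φ hξ =>
    rw [algebraMapInv_extDelta'_ι_mul, ← hξ, contractR_extDelta, algebraMapInv_contractR,
      map_mul, Module.End.mul_apply]

lemma dual_extE (φ : Module.Dual R M) (x : ExteriorAlgebra R M)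
    (ξ : ExteriorAlgebra R (Module.Dual R M)) (m : M) :
    φ (extE R M x ξ m) = algebraMapInv (extDelta' R M (contractR φ x * ι R m) ξ) := by
  change φ (ιInv (extDelta R M (extDelta' R M (ι R m) ξ) x)) = _
  rw [dual_ιInv, ← Module.End.mul_apply, ← map_mul, algebraMapInv_extDelta_eq,
    algebraMapInv_extDelta'_ι_mul, map_mul, Module.End.mul_apply]

lemma mul_eq_neg_one_pow_smul_mul {k n : ℕ} {b c : ExteriorAlgebra R M}
    (hc : ∀ v : M, ι R v * c = (-1 : R) ^ k • (c * ι R v)) (hb : b ∈ ⋀[R]^n M) :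
    b * c = (-1 : R) ^ (n * k) • (c * b) := by
  induction hb using Submodule.pow_induction_on_left' with
  | algebraMap r => simp [Algebra.commutes]
  | add a b i _ _ ha hb => simp [add_mul, mul_add, ha, hb]
  | mem_mul m hm i b _ ih =>
    obtain ⟨v, rfl⟩ := hm
    rw [mul_assoc, ih, mul_smul_comm, ← mul_assoc, hc, smul_mul_assoc, smul_smul, mul_assoc,
      Nat.succ_mul, pow_add]

lemma ι_mul_eq_neg_one_pow_smul {n : ℕ} {c : ExteriorAlgebra R M} (hc : c ∈ ⋀[R]^n M) (v : M) :
    ι R v * c = (-1 : R) ^ n • (c * ι R v) := by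
  have h := mul_eq_neg_one_pow_smul_mul (k := 1) (c := ι R v) (fun w => by
    rw [pow_one, neg_one_smul]
    exact eq_neg_of_add_eq_zero_left (ι_add_mul_swap w v)) hc
  rw [h, smul_smul, mul_one, ← mul_pow]
  simp

/-- Graded commutativity of the exterior algebra. -/
lemma exteriorPower_mul_comm {p q : ℕ} {b c : ExteriorAlgebra R M}
    (hb : b ∈ ⋀[R]^p M) (hc : c ∈ ⋀[R]^q M) :
    b * c = (-1 : R) ^ (p * q) • (c * b) :=
  mul_eq_neg_one_pow_smul_mul (ι_mul_eq_neg_one_pow_smul hc) hb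

lemma contractR_mul (φ : Module.Dual R M) {n : ℕ} (a : ExteriorAlgebra R M)
    {b : ExteriorAlgebra R M} (hb : b ∈ ⋀[R]^n M) :
    contractR φ (a * b) = a * contractR φ b + (-1 : R) ^ n • (contractR φ a * b) := by
  induction hb using Submodule.pow_induction_on_right' with
  | algebraMap r =>
    rw [contractR_algebraMap, ← Algebra.commutes, ← Algebra.commutes, ← Algebra.smul_def,
      ← Algebra.smul_def, map_smul]
    simp
  | add b c i _ _ hb hc =>
    simp only [mul_add, map_add, smul_add, hb, hc]
    abel
  | mul_mem i b _ ih m hm =>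
    obtain ⟨v, rfl⟩ := hm
    rw [← mul_assoc, contractR_mul_ι, contractR_mul_ι, ih, pow_succ, mul_neg_one, neg_smul,
      mul_sub, add_mul, mul_smul_comm, smul_mul_assoc, mul_assoc, mul_assoc]
    abel

lemma ι_mul_contractR (φ : Module.Dual R M) {n : ℕ} {b : ExteriorAlgebra R M}
    (hb : b ∈ ⋀[R]^n M) (v : M) :
    ι R v * contractR φ b = (-1 : R) ^ (n + 1) • (contractR φ b * ι R v) := by
  have hv : contractR φ (ι R v) = algebraMap R _ (φ v) :=
    CliffordAlgebra.contractRight_ι (Q := (0 : QuadraticForm R M)) φ v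
  have h := congrArg (contractR φ) (ι_mul_eq_neg_one_pow_smul hb v)
  rw [contractR_mul φ _ hb, map_smul, contractR_mul_ι, hv, ← Algebra.smul_def, smul_sub,
    sub_eq_neg_add, add_right_cancel_iff] at h
  rw [h, pow_succ, mul_neg_one, neg_smul]

/-- Elements of even degree are central. -/
lemma exteriorPower_commute {n : ℕ} {b : ExteriorAlgebra R M} (hb : b ∈ ⋀[R]^n M)
    (hn : Even n) (a : ExteriorAlgebra R M) : Commute a b := by
  induction a using exteriorAlgebra_left_induction with
  | algebraMap r => exact Algebra.commutes r b
  | add a c ha hc => exact ha.add_left hc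
  | ι_mul a m ha =>
    refine Commute.mul_left ?_ ha
    rw [commute_iff_eq, ι_mul_eq_neg_one_pow_smul hb, hn.neg_one_pow, one_smul]

lemma contractR_mul_mul_mul (φ : Module.Dual R M) {l : ℕ} {x y z : ExteriorAlgebra R M}
    (hx : x ∈ ⋀[R]^l M) (hy : y ∈ ⋀[R]^l M) (hz : z ∈ ⋀[R]^l M) (c : ExteriorAlgebra R M) :
    contractR φ (x * y * z) * c =
      contractR φ x * c * (y * z) + contractR φ y * c * (z * x) + contractR φ z * c * (x * y) := by
  have comm {a b : ExteriorAlgebra R M} (ha : a ∈ ⋀[R]^l M) (hb : b ∈ ⋀[R]^l M) :=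
    exteriorPower_commute (n := l + l) (SetLike.mul_mem_graded ha hb) ⟨l, rfl⟩
  have hzy : z * contractR φ y = contractR φ y * z := by
    rw [mul_eq_neg_one_pow_smul_mul (ι_mul_contractR φ hy) hz,
      (Nat.even_mul_succ_self l).neg_one_pow, one_smul]
  have hxz : (-1 : R) ^ l • (x * z) = z * x := by
    rw [exteriorPower_mul_comm hx hz, smul_smul, ← pow_add,
      show l + l * l = l * (l + 1) by ring, (Nat.even_mul_succ_self l).neg_one_pow, one_smul]
  have h : (-1 : R) ^ l • (x * contractR φ y * z) = contractR φ y * (z * x) := by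
    rw [mul_assoc, ← hzy, ← mul_assoc, ← smul_mul_assoc, hxz, (comm hz hx _).eq]
  rw [contractR_mul φ _ hz, contractR_mul φ _ hy, add_mul _ _ z, smul_add, smul_mul_assoc, smul_smul,
    ← mul_pow, neg_one_mul, neg_neg, one_pow, one_smul, h, mul_assoc (contractR φ x) y z,
    ← (comm hx hy _).eq]
  simp only [add_mul, mul_assoc _ c]
  rw [(comm hx hy c).eq, (comm hy hz c).eq, (comm hz hx c).eq]
  simp only [mul_assoc]
  abel

end

/-- For a finitely generated projective module `M`, `x, y, z ∈ Λ_l(M)`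
and `μ ∈ Λ_{3l}(M*)`, one has `e(xyz, μ) = e(x,(yz)·μ) + e(y,(zx)·μ) + e(z,(xy)·μ)`
in `End(M)`. -/
theorem extE_triple_cyclic
    (R : Type*) [CommRing R] (M : Type*) [AddCommGroup M] [Module R M]
    [Module.Finite R M] [Module.Projective R M] (l : ℕ)
    (x y z : ExteriorAlgebra R M)
    (hx : x ∈ ⋀[R]^l M) (hy : y ∈ ⋀[R]^l M) (hz : z ∈ ⋀[R]^l M)
    (μ : ExteriorAlgebra R (Module.Dual R M)) (hμ : μ ∈ ⋀[R]^(3 * l) (Module.Dual R M)) :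
    extE R M (x * y * z) μ =
      extE R M x (extDelta' R M (y * z) μ) + extE R M y (extDelta' R M (z * x) μ) +
        extE R M z (extDelta' R M (x * y) μ) := by
  refine LinearMap.ext fun m => sub_eq_zero.mp ((Module.forall_dual_apply_eq_zero_iff R _).mp
    fun φ => ?_)
  rw [map_sub, sub_eq_zero]
  simp only [LinearMap.add_apply, map_add, dual_extE]
  simp only [← Module.End.mul_apply, ← map_mul]
  rw [contractR_mul_mul_mul φ hx hy hz]
  simp only [map_add, LinearMap.add_apply]
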